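/- Let c₁, c₂, c₃ be real numbers such that ρ(c₁,c₂,c₃) is positive semidefinite, set c := max(|c₁|, |c₂|), assume |c₃| ≤ c, and let q₁ := 2 / (2 + c + √(c² + 4(c − c₃))). Then for p ∈ [0,1] and q := 1 − p: if q ≥ q₁, then F_RSP(Φ_p(ρ(c₁,c₂,c₃))) = ½[ q²(c₁² + c₂² − c²) + (c₃ q² + (1 − q)²)² ]; and if 0 ≤ q < q₁, then F_RSP(Φ_p(ρ(c₁,c₂,c₃))) = ½ q² (c₁² + c₂²). -/

import Mathlib

open Matrix Kronecker ComplexOrder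

noncomputable section

def pauli : Fin 3 → Matrix (Fin 2) (Fin 2) ℂ :=
  ![!![0, 1; 1, 0], !![0, -Complex.I; Complex.I, 0], !![1, 0; 0, -1]]

def corr (ρ : Matrix (Fin 2 × Fin 2) (Fin 2 × Fin 2) ℂ) : Matrix (Fin 3) (Fin 3) ℝ :=
  Matrix.of fun k l => (Matrix.trace (ρ * (pauli k ⊗ₖ pauli l))).re

def lambdaMax (M : Matrix (Fin 3) (Fin 3) ℝ) : ℝ :=
  sSup {x : ℝ | ∃ v : Fin 3 → ℝ, v ≠ 0 ∧ M.mulVec v = x • v}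

def Frsp (ρ : Matrix (Fin 2 × Fin 2) (Fin 2 × Fin 2) ℂ) : ℝ :=
  (1 / 2) * (Matrix.trace ((corr ρ)ᵀ * corr ρ) - lambdaMax ((corr ρ)ᵀ * corr ρ))

def damp (p : ℝ) : Fin 2 → Matrix (Fin 2) (Fin 2) ℂ :=
  ![!![1, 0; 0, (Real.sqrt (1 - p) : ℂ)], !![0, (Real.sqrt p : ℂ); 0, 0]]

def Phi (p : ℝ) (ρ : Matrix (Fin 2 × Fin 2) (Fin 2 × Fin 2) ℂ) :
    Matrix (Fin 2 × Fin 2) (Fin 2 × Fin 2) ℂ :=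
  ∑ i : Fin 2, ∑ j : Fin 2, (damp p i ⊗ₖ damp p j) * ρ * (damp p i ⊗ₖ damp p j)ᴴ

def bellDiag (c₁ c₂ c₃ : ℝ) : Matrix (Fin 2 × Fin 2) (Fin 2 × Fin 2) ℂ :=
  (1 / 4 : ℂ) • (1 + (c₁ : ℂ) • (pauli 0 ⊗ₖ pauli 0) + (c₂ : ℂ) • (pauli 1 ⊗ₖ pauli 1)
    + (c₃ : ℂ) • (pauli 2 ⊗ₖ pauli 2))

def bloch (ρ : Matrix (Fin 2 × Fin 2) (Fin 2 × Fin 2) ℂ) : Fin 3 → ℝ :=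
  fun k => (Matrix.trace (ρ * (pauli k ⊗ₖ (1 : Matrix (Fin 2) (Fin 2) ℂ)))).re

def Dg (ρ : Matrix (Fin 2 × Fin 2) (Fin 2 × Fin 2) ℂ) : ℝ :=
  (1 / 2) * ((∑ k, bloch ρ k ^ 2) + Matrix.trace (corr ρ * (corr ρ)ᵀ)
    - lambdaMax (Matrix.vecMulVec (bloch ρ) (bloch ρ) + corr ρ * (corr ρ)ᵀ))


/-- The single-qubit amplitude damping channel. -/
def ampDamp (p : ℝ) (A : Matrix (Fin 2) (Fin 2) ℂ) : Matrix (Fin 2) (Fin 2) ℂ :=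
  ∑ i : Fin 2, damp p i * A * (damp p i)ᴴ

theorem Phi_kronecker (p : ℝ) (A B : Matrix (Fin 2) (Fin 2) ℂ) :
    Phi p (A ⊗ₖ B) = ampDamp p A ⊗ₖ ampDamp p B := by
  simp only [Phi, ampDamp, conjTranspose_kronecker, ← mul_kronecker_mul, Fin.sum_univ_two,
    add_kronecker, kronecker_add]
  exact add_add_add_comm _ _ _ _

theorem Phi_add (p : ℝ) (A B : Matrix (Fin 2 × Fin 2) (Fin 2 × Fin 2) ℂ) :
    Phi p (A + B) = Phi p A + Phi p B := by
  simp only [Phi, Matrix.mul_add, Matrix.add_mul, Finset.sum_add_distrib]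

theorem Phi_smul (p : ℝ) (z : ℂ) (A : Matrix (Fin 2 × Fin 2) (Fin 2 × Fin 2) ℂ) :
    Phi p (z • A) = z • Phi p A := by
  simp only [Phi, Matrix.mul_smul, Matrix.smul_mul, Finset.smul_sum]

theorem ampDamp_apply {p : ℝ} (hp : p ∈ Set.Icc (0 : ℝ) 1) (A : Matrix (Fin 2) (Fin 2) ℂ) :
    ampDamp p A = !![A 0 0 + p * A 1 1, (Real.sqrt (1 - p) : ℂ) * A 0 1;
      (Real.sqrt (1 - p) : ℂ) * A 1 0, (1 - p) * A 1 1] := by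
  have h₁ : (Real.sqrt p : ℂ) * Real.sqrt p = p := by
    exact_mod_cast Real.mul_self_sqrt hp.1
  have h₂ : (Real.sqrt (1 - p) : ℂ) * Real.sqrt (1 - p) = 1 - p := by
    exact_mod_cast Real.mul_self_sqrt (sub_nonneg.2 hp.2)
  ext i j
  rw [eta_fin_two A]
  fin_cases i <;> fin_cases j <;>
    simp [ampDamp, damp, Fin.sum_univ_two, vecMul_eq_sum, conjTranspose_apply]
  · linear_combination (A 1 1) * h₁
  · ring
  · linear_combination (A 1 1) * h₂

theorem corr_Phi_bellDiag {p : ℝ} (hp : p ∈ Set.Icc (0 : ℝ) 1) (c₁ c₂ c₃ : ℝ) :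
    corr (Phi p (bellDiag c₁ c₂ c₃)) =
      diagonal ![(1 - p) * c₁, (1 - p) * c₂, c₃ * (1 - p) ^ 2 + p ^ 2] := by
  have h₂ : Real.sqrt (1 - p) * Real.sqrt (1 - p) = 1 - p :=
    Real.mul_self_sqrt (sub_nonneg.2 hp.2)
  ext k l
  rw [corr, of_apply, bellDiag, ← one_kronecker_one]
  simp only [Phi_smul, Phi_add, Phi_kronecker, smul_mul, Matrix.add_mul, trace_smul, trace_add,
    ← mul_kronecker_mul, trace_kronecker, ampDamp_apply hp]
  fin_cases k <;> fin_cases l <;>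
    simp [pauli, trace_fin_two]
  · linear_combination c₁ * h₂
  · linear_combination c₂ * h₂
  · ring

theorem lambdaMax_diagonal (d : Fin 3 → ℝ) (i : Fin 3) (hi : ∀ j, d j ≤ d i) :
    lambdaMax (diagonal d) = d i := by
  refine IsGreatest.csSup_eq ⟨⟨Pi.single i 1, by simp, ?_⟩, ?_⟩
  · ext j
    rcases eq_or_ne j i with rfl | hj <;> simp [mulVec_diagonal, *]
  · rintro x ⟨v, hv, hx⟩
    obtain ⟨j, hj⟩ := Function.ne_iff.1 hv
    have h := congrFun hx j
    rw [mulVec_diagonal, Pi.smul_apply, smul_eq_mul] at h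
    exact mul_right_cancel₀ hj h ▸ hi j

theorem Frsp_of_corr_eq_diagonal {ρ : Matrix (Fin 2 × Fin 2) (Fin 2 × Fin 2) ℂ} {d : Fin 3 → ℝ}
    (hρ : corr ρ = diagonal d) (i : Fin 3) (hi : ∀ j, d j ^ 2 ≤ d i ^ 2) :
    Frsp ρ = (1 / 2) * (∑ j, d j ^ 2 - d i ^ 2) := by
  have h : (corr ρ)ᵀ * corr ρ = diagonal fun j => d j ^ 2 := by
    rw [hρ, diagonal_transpose, diagonal_mul_diagonal]
    simp only [sq]
  rw [Frsp, h, lambdaMax_diagonal _ i hi, trace_diagonal]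

/-- Piecewise form of the RSP-fidelity of a Bell-diagonal state under the
symmetric local amplitude damping channel, for |c₃| ≤ c = max(|c₁|,|c₂|). -/
theorem frsp_damping_piecewise
    (c₁ c₂ c₃ : ℝ) (hpsd : (bellDiag c₁ c₂ c₃).PosSemidef)
    (c : ℝ) (hc : c = max |c₁| |c₂|) (hc₃ : |c₃| ≤ c)
    (q₁ : ℝ) (hq₁ : q₁ = 2 / (2 + c + Real.sqrt (c ^ 2 + 4 * (c - c₃))))
    (p : ℝ) (hp : p ∈ Set.Icc (0 : ℝ) 1) (q : ℝ) (hq : q = 1 - p) :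
    (q₁ ≤ q → Frsp (Phi p (bellDiag c₁ c₂ c₃)) =
      (1 / 2) * (q ^ 2 * (c₁ ^ 2 + c₂ ^ 2 - c ^ 2) + (c₃ * q ^ 2 + (1 - q) ^ 2) ^ 2)) ∧
    (0 ≤ q → q < q₁ → Frsp (Phi p (bellDiag c₁ c₂ c₃)) =
      (1 / 2) * q ^ 2 * (c₁ ^ 2 + c₂ ^ 2)) := by
  have h₁ : |c₁| ≤ c := hc ▸ le_max_left _ _
  have h₂ : |c₂| ≤ c := hc ▸ le_max_right _ _
  have h_nonneg : 0 ≤ c := (abs_nonneg _).trans h₁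
  have h₁_sq : c₁ ^ 2 ≤ c ^ 2 := sq_le_sq.2 (h₁.trans (le_abs_self c))
  have h₂_sq : c₂ ^ 2 ≤ c ^ 2 := sq_le_sq.2 (h₂.trans (le_abs_self c))
  have hq₁_sq : (q * c₁) ^ 2 ≤ (q * c) ^ 2 := by
    rw [mul_pow, mul_pow]; gcongr
  have hq₂_sq : (q * c₂) ^ 2 ≤ (q * c) ^ 2 := by
    rw [mul_pow, mul_pow]; gcongr
  obtain ⟨h₃, h₃'⟩ := abs_le.1 hc₃
  have hE := corr_Phi_bellDiag hp c₁ c₂ c₃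
  have hp_eq : p = 1 - q := by linarith
  rw [← hq, hp_eq] at hE
  rw [hp_eq]
  have hq_le : q ≤ 1 := by linarith [hp.1]
  have hq_nonneg : 0 ≤ q := by linarith [hp.2]
  set s := Real.sqrt (c ^ 2 + 4 * (c - c₃)) with hs
  have hs_sq : s ^ 2 = c ^ 2 + 4 * (c - c₃) := Real.sq_sqrt (by nlinarith)
  have hs_nonneg : 0 ≤ s := Real.sqrt_nonneg _
  have hcs : c ≤ s := Real.le_sqrt_of_sq_le (by linarith)
  have h_pos : 0 < 2 + c + s := by linarith
  have h_factor : 4 * (c₃ * q ^ 2 + (1 - q) ^ 2 - q * c) =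
      (2 - q * (2 + c + s)) * (2 - q * (2 + c - s)) := by
    linear_combination q ^ 2 * hs_sq
  have h_right : 0 ≤ 2 - q * (2 + c - s) := by nlinarith
  constructor
  · intro h
    rw [hq₁, div_le_iff₀ h_pos] at h
    have h_le : c₃ * q ^ 2 + (1 - q) ^ 2 ≤ q * c := by nlinarith
    have h_ge : -(q * c) ≤ c₃ * q ^ 2 + (1 - q) ^ 2 := by
      nlinarith [sq_nonneg (1 - q), mul_nonneg (mul_nonneg hq_nonneg h_nonneg) (sub_nonneg.2 hq_le),
        mul_nonneg (sq_nonneg q) (neg_le_iff_add_nonneg.1 h₃)]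
    have h_sq : (c₃ * q ^ 2 + (1 - q) ^ 2) ^ 2 ≤ (q * c) ^ 2 := sq_le_sq' h_ge h_le
    rcases max_choice |c₁| |c₂| with hm | hm
    · have h_eq : c ^ 2 = c₁ ^ 2 := by rw [hc, hm, sq_abs]
      rw [Frsp_of_corr_eq_diagonal hE 0, Fin.sum_univ_three]
      · simp only [cons_val]
        linear_combination (q ^ 2 / 2) * h_eq
      · have h_eq' : (q * c) ^ 2 = (q * c₁) ^ 2 := by rw [mul_pow, mul_pow, h_eq]
        intro j
        fin_cases j <;> simp only [cons_val, Fin.reduceFinMk, Fin.zero_eta, Fin.mk_one] <;>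
          linarith
    · have h_eq : c ^ 2 = c₂ ^ 2 := by rw [hc, hm, sq_abs]
      rw [Frsp_of_corr_eq_diagonal hE 1, Fin.sum_univ_three]
      · simp only [cons_val]
        linear_combination (q ^ 2 / 2) * h_eq
      · have h_eq' : (q * c) ^ 2 = (q * c₂) ^ 2 := by rw [mul_pow, mul_pow, h_eq]
        intro j
        fin_cases j <;> simp only [cons_val, Fin.reduceFinMk, Fin.zero_eta, Fin.mk_one] <;>
          linarith
  · intro _ h
    rw [hq₁, lt_div_iff₀ h_pos] at h
    have h_ge : q * c ≤ c₃ * q ^ 2 + (1 - q) ^ 2 := by nlinarith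
    have h_sq : (q * c) ^ 2 ≤ (c₃ * q ^ 2 + (1 - q) ^ 2) ^ 2 :=
      pow_le_pow_left₀ (mul_nonneg hq_nonneg h_nonneg) h_ge 2
    rw [Frsp_of_corr_eq_diagonal hE 2, Fin.sum_univ_three]
    · simp only [cons_val]
      ring
    · intro j
      fin_cases j <;> simp only [cons_val, Fin.reduceFinMk, Fin.zero_eta, Fin.mk_one] <;>
        linarith

end
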